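/- arXiv:2501.14444 — 2 statements merged into one kernel-verified Lean document; each statement's English description precedes it below -/
import Mathlib

section
/- Let p be a prime and n a positive integer. For a positive integer a, let B(a) be the 2a×2a matrix over ℚ_p with entries B(a)₍₀,₀₎ = 1, B(a)₍₂ₐ₋₁,₂ₐ₋₁₎ = p, B(a)₍ᵢ,ᵢ₊₁₎ = B(a)₍ᵢ₊₁,ᵢ₎ = 1 for every odd index i with 1 ≤ i ≤ 2a−3, and all other entries 0. For a list l = [a₁, …, a_k] of positive integers with a₁ + ⋯ + a_k = n, let M(l) be the 2n×2n matrix over ℚ_p obtained from the block-diagonal matrix with diagonal blocks B(a₁), …, B(a_k) (in order) via the canonical order-preserving identification of the index type Σ i : Fin k, Fin (2·aᵢ) with Fin (2n). Then for any two lists l and l' of positive integers, each summing to n, which are distinct as multisets, there is no symplectic 2n×2n matrix S over ℚ_p with Sᵀ * M(l) * S = M(l'). -/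
open Matrix

/-- The building block `B(a)`: a `2a × 2a` matrix over `ℚ_p` with `1` in position
`(0,0)`, `p` in position `(2a-1, 2a-1)`, `1` in positions `(i, i+1)` and `(i+1, i)`
for odd `i`, and `0` elsewhere. -/
noncomputable def Bblock (p : ℕ) [Fact p.Prime] (a : ℕ) : Matrix (Fin (2 * a)) (Fin (2 * a)) ℚ_[p] :=
  fun i j =>
    if (i : ℕ) = 0 ∧ (j : ℕ) = 0 then 1
    else if (i : ℕ) = 2 * a - 1 ∧ (j : ℕ) = 2 * a - 1 then (p : ℚ_[p])
    else if (i : ℕ) % 2 = 1 ∧ (j : ℕ) = (i : ℕ) + 1 then 1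
    else if (j : ℕ) % 2 = 1 ∧ (i : ℕ) = (j : ℕ) + 1 then 1
    else 0

/-- The standard symplectic form on `(ℚ_p)^(2n)`. -/
noncomputable def OmegaList (p : ℕ) [Fact p.Prime] (n : ℕ) :
    Matrix (Fin (2 * n)) (Fin (2 * n)) ℚ_[p] :=
  fun i j =>
    if (i : ℕ) % 2 = 0 ∧ (j : ℕ) = (i : ℕ) + 1 then 1
    else if (j : ℕ) % 2 = 0 ∧ (i : ℕ) = (j : ℕ) + 1 then -1
    else 0

/-- The canonical order-preserving identification of `Σ i : Fin k, Fin (a i)` (with the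
lexicographic, i.e. block-concatenating, order) with `Fin (∑ i, a i)`. -/
noncomputable def blockEquiv (k : ℕ) (a : Fin k → ℕ) :
    (Σ i : Fin k, Fin (a i)) ≃ Fin (∑ i, a i) :=
  (toLex (α := Σ i : Fin k, Fin (a i))).trans
    (Fintype.orderIsoFinOfCardEq (Σₗ i : Fin k, Fin (a i))
      (by
        rw [show Fintype.card (Σₗ i : Fin k, Fin (a i)) =
              Fintype.card (Σ i : Fin k, Fin (a i)) from
            Fintype.card_congr (toLex (α := Σ i : Fin k, Fin (a i))).symm]
        simp)).toEquiv.symm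

/-- The block-diagonal matrix `M(l)` with blocks `B(a₁), …, B(a_k)` for
`l = [a₁, …, a_k]`, reindexed to `Fin (2n)` via the canonical order-preserving
identification. -/
noncomputable def Mlist (p : ℕ) [Fact p.Prime] (n : ℕ) (l : List ℕ) (h : l.sum = n) :
    Matrix (Fin (2 * n)) (Fin (2 * n)) ℚ_[p] :=
  Matrix.reindex
    ((blockEquiv l.length fun i => 2 * l.get i).trans (finCongr (by
      rw [← Finset.mul_sum]
      congr 1
      rw [← List.sum_ofFn, List.ofFn_get, h])))
    ((blockEquiv l.length fun i => 2 * l.get i).trans (finCongr (by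
      rw [← Finset.mul_sum]
      congr 1
      rw [← List.sum_ofFn, List.ofFn_get, h])))
    (Matrix.blockDiagonal' fun i : Fin l.length => Bblock p (l.get i))

theorem Matrix.charpoly_blockDiagonal' {R ι : Type*} [CommRing R] [Fintype ι] [LinearOrder ι]
    {m : ι → Type*} [∀ i, Fintype (m i)] [∀ i, DecidableEq (m i)]
    (M : ∀ i, Matrix (m i) (m i) R) :
    (blockDiagonal' M).charpoly = ∏ i, (M i).charpoly := by
  have key (i : ι) :
      ((blockDiagonal' M).toSquareBlock Sigma.fst i).charpoly = (M i).charpoly := by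
    rw [← charpoly_reindex (Equiv.sigmaSubtype i)]
    congr 1
    ext x y
    simp [toSquareBlock_def, Equiv.sigmaSubtype, blockDiagonal'_apply]
  rw [(blockTriangular_blockDiagonal' M).charpoly]
  simp_rw [key]
  refine Finset.prod_subset (Finset.subset_univ _) fun i _ hi => ?_
  have : IsEmpty (m i) := ⟨fun x => hi (Finset.mem_image.2 ⟨⟨i, x⟩, Finset.mem_univ _, rfl⟩)⟩
  simp [Matrix.charpoly]

theorem finSigmaFinEquiv_strictMono (k : ℕ) (a : Fin k → ℕ) :
    StrictMono fun x : Σₗ i : Fin k, Fin (a i) => finSigmaFinEquiv (ofLex x) := by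
  intro x y hxy
  obtain ⟨⟨i, s⟩, rfl⟩ := toLex.surjective x
  obtain ⟨⟨j, t⟩, rfl⟩ := toLex.surjective y
  rw [Fin.lt_def, finSigmaFinEquiv_apply, finSigmaFinEquiv_apply]
  rcases Sigma.Lex.lt_def.1 hxy with h | ⟨h, hst⟩
  · have hij : (i : ℕ) + 1 ≤ j := h
    have hle : ∑ u : Fin (i + 1), a (Fin.castLE i.2 u) ≤
        ∑ u : Fin j, a (Fin.castLE j.2.le u) := by
      let e : Fin (i + 1) ↪ Fin j := Fin.castLEEmb hij
      calc ∑ u : Fin (i + 1), a (Fin.castLE i.2 u)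
          = ∑ u ∈ Finset.univ.map e, a (Fin.castLE j.2.le u) := by
            rw [Finset.sum_map]; rfl
        _ ≤ _ := Finset.sum_le_sum_of_subset (Finset.subset_univ _)
    rw [Fin.sum_univ_castSucc] at hle
    exact ((Nat.add_lt_add_left s.2 _).trans_le hle).trans_le (Nat.le_add_right _ _)
  · change i = j at h
    subst h
    have : (s : ℕ) < t := hst
    exact Nat.add_lt_add_left this _

theorem blockEquiv_eq_finSigmaFinEquiv (k : ℕ) (a : Fin k → ℕ) :
    blockEquiv k a = finSigmaFinEquiv := by
  let f : (Σₗ i : Fin k, Fin (a i)) ≃o Fin (∑ i, a i) :=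
    (finSigmaFinEquiv_strictMono k a).orderIsoOfSurjective _
      (finSigmaFinEquiv.surjective.comp ofLex.surjective)
  ext x
  have h := Subsingleton.elim (Fintype.orderIsoFinOfCardEq (Σₗ i : Fin k, Fin (a i))
    (by
      rw [show Fintype.card (Σₗ i : Fin k, Fin (a i)) =
            Fintype.card (Σ i : Fin k, Fin (a i)) from
          Fintype.card_congr (toLex (α := Σ i : Fin k, Fin (a i))).symm]
      simp)) f.symm
  simp only [blockEquiv, Equiv.trans_apply, h]
  rfl

theorem exists_blockEquiv_two_mul_val (k : ℕ) (a : Fin k → ℕ) (i : Fin k) :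
    ∃ c : ℕ, ∀ s : Fin (2 * a i),
      (blockEquiv k (fun i => 2 * a i) ⟨i, s⟩ : ℕ) = 2 * c + s := by
  refine ⟨∑ u : Fin i, a (Fin.castLE i.2.le u), fun s => ?_⟩
  rw [blockEquiv_eq_finSigmaFinEquiv, finSigmaFinEquiv_apply, Finset.mul_sum]

theorem OmegaList_eq_reindex (p : ℕ) [Fact p.Prime] (n k : ℕ) (a : Fin k → ℕ)
    (h : ∑ i, 2 * a i = 2 * n) :
    OmegaList p n =
      Matrix.reindex ((blockEquiv k fun i => 2 * a i).trans (finCongr h))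
        ((blockEquiv k fun i => 2 * a i).trans (finCongr h))
        (Matrix.blockDiagonal' fun i => OmegaList p (a i)) := by
  set e := (blockEquiv k fun i => 2 * a i).trans (finCongr h) with he
  have hval (i : Fin k) : ∃ c : ℕ, ∀ s : Fin (2 * a i), (e ⟨i, s⟩ : ℕ) = 2 * c + s := by
    simpa [he] using exists_blockEquiv_two_mul_val k a i
  have hsucc (i j : Fin k) (s : Fin (2 * a i)) (t : Fin (2 * a j)) (hs : (s : ℕ) % 2 = 0)
      (hst : (e ⟨j, t⟩ : ℕ) = e ⟨i, s⟩ + 1) : i = j := by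
    obtain ⟨c, hc⟩ := hval i
    have hs1 : (s : ℕ) + 1 < 2 * a i := by omega
    have : e ⟨j, t⟩ = e ⟨i, ⟨s + 1, hs1⟩⟩ := by
      apply Fin.ext
      rw [hst, hc, hc]
      simp [add_assoc]
    exact (congrArg Sigma.fst (e.injective this)).symm
  ext x y
  obtain ⟨⟨i, s⟩, rfl⟩ := e.surjective x
  obtain ⟨⟨j, t⟩, rfl⟩ := e.surjective y
  rw [Matrix.reindex_apply, Matrix.submatrix_apply, Equiv.symm_apply_apply,
    Equiv.symm_apply_apply]
  by_cases hij : i = j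
  · subst hij
    obtain ⟨c, hc⟩ := hval i
    rw [Matrix.blockDiagonal'_apply_eq]
    simp only [OmegaList, hc]
    congr 1
    · apply propext; omega
    · congr 1
      apply propext; omega
  · rw [Matrix.blockDiagonal'_apply_ne _ _ _ hij, OmegaList, if_neg, if_neg]
    · rintro ⟨h1, h2⟩
      obtain ⟨c, hc⟩ := hval j
      exact hij (hsucc j i t s (by rw [hc] at h1; omega) h2).symm
    · rintro ⟨h1, h2⟩
      obtain ⟨c, hc⟩ := hval i
      exact hij (hsucc i j s t (by rw [hc] at h1; omega) h2)

theorem OmegaList_mul_self (p : ℕ) [Fact p.Prime] (n : ℕ) :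
    OmegaList p n * OmegaList p n = -1 := by
  ext i j
  let i' : Fin (2 * n) := ⟨if (i : ℕ) % 2 = 0 then i + 1 else i - 1, by split_ifs <;> omega⟩
  have hi' : (i' : ℕ) = if (i : ℕ) % 2 = 0 then (i : ℕ) + 1 else i - 1 := rfl
  rw [Matrix.mul_apply, Finset.sum_eq_single i']
  · simp only [OmegaList, Matrix.neg_apply, Matrix.one_apply, Fin.ext_iff, hi']
    split_ifs <;> first | omega | simp
  · intro b _ hb
    have : OmegaList p n i b = 0 := by
      rw [Ne, Fin.ext_iff, hi'] at hb
      simp only [OmegaList]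
      split_ifs at hb ⊢ <;> first | omega | rfl
    simp [this]
  · simp

section BlockVectors

variable (p : ℕ) [Fact p.Prime] (a : ℕ)

/-- The `k`-th standard basis vector of `ℚ_p ^ (2 * a)`, and `0` when `2 * a ≤ k`. -/
noncomputable def stdVec (k : ℕ) : Fin (2 * a) → ℚ_[p] := fun i => if (i : ℕ) = k then 1 else 0

variable {a}

theorem mulVec_stdVec (M : Matrix (Fin (2 * a)) (Fin (2 * a)) ℚ_[p]) (k : Fin (2 * a)) :
    M *ᵥ stdVec p a k = fun i => M i k := by
  have : stdVec p a k = Pi.single k 1 := by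
    ext i
    simp [stdVec, Pi.single_apply, Fin.ext_iff]
  rw [this, Matrix.mulVec_single_one]
  rfl

theorem Omega_mulVec_even {k : ℕ} (hk : k < a) :
    OmegaList p a *ᵥ stdVec p a (2 * k) = -stdVec p a (2 * k + 1) := by
  rw [mulVec_stdVec p (OmegaList p a) ⟨2 * k, by omega⟩]
  ext i
  simp only [OmegaList, stdVec, Pi.neg_apply]
  split_ifs <;> first | omega | simp

theorem Omega_mulVec_odd {k : ℕ} (hk : k < a) :
    OmegaList p a *ᵥ stdVec p a (2 * k + 1) = stdVec p a (2 * k) := by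
  rw [mulVec_stdVec p (OmegaList p a) ⟨2 * k + 1, by omega⟩]
  ext i
  simp only [OmegaList, stdVec]
  split_ifs <;> first | omega | simp

theorem Bblock_mulVec_zero (ha : 0 < a) :
    Bblock p a *ᵥ stdVec p a 0 = stdVec p a 0 := by
  rw [mulVec_stdVec p (Bblock p a) ⟨0, by omega⟩]
  ext i
  simp only [Bblock, stdVec]
  split_ifs <;> first | omega | (simp; done) | (exfalso; simp at * <;> omega)

theorem Bblock_mulVec_last (ha : 0 < a) :
    Bblock p a *ᵥ stdVec p a (2 * a - 1) = (p : ℚ_[p]) • stdVec p a (2 * a - 1) := by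
  rw [mulVec_stdVec p (Bblock p a) ⟨2 * a - 1, by omega⟩]
  ext i
  simp only [Bblock, stdVec, Pi.smul_apply]
  split_ifs <;> first | omega | (simp; done) | (exfalso; simp at *; omega)

theorem Bblock_mulVec_odd {k : ℕ} (hk : k + 1 < a) :
    Bblock p a *ᵥ stdVec p a (2 * k + 1) = stdVec p a (2 * k + 2) := by
  rw [mulVec_stdVec p (Bblock p a) ⟨2 * k + 1, by omega⟩]
  ext i
  simp only [Bblock, stdVec]
  split_ifs <;> first | omega | (simp; done) | (exfalso; simp at *)

theorem Bblock_mulVec_even {k : ℕ} (hk : k + 1 < a) :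
    Bblock p a *ᵥ stdVec p a (2 * k + 2) = stdVec p a (2 * k + 1) := by
  rw [mulVec_stdVec p (Bblock p a) ⟨2 * k + 2, by omega⟩]
  ext i
  simp only [Bblock, stdVec]
  split_ifs <;> first | omega | (simp; done) | (exfalso; simp at *)

theorem Omega_mul_Bblock_pow_mulVec_ascending {k : ℕ} (hk : k < a) :
    (OmegaList p a * Bblock p a) ^ (k + 1) *ᵥ stdVec p a 0 =
      (-1 : ℚ_[p]) ^ (k + 1) • stdVec p a (2 * k + 1) := by
  induction k with
  | zero =>
    rw [zero_add, pow_one, ← Matrix.mulVec_mulVec, Bblock_mulVec_zero p hk]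
    simpa using Omega_mulVec_even p hk
  | succ k ih =>
    rw [pow_succ', ← Matrix.mulVec_mulVec, ih (by omega), Matrix.mulVec_smul,
      ← Matrix.mulVec_mulVec, Bblock_mulVec_odd p hk, show 2 * k + 2 = 2 * (k + 1) by ring,
      Omega_mulVec_even p hk, pow_succ _ (k + 1)]
    simp

theorem Omega_mul_Bblock_pow_mulVec_descending {k j : ℕ} (hk : k + j + 1 = a) :
    (OmegaList p a * Bblock p a) ^ (a + k + 1) *ᵥ stdVec p a 0 =
      ((-1 : ℚ_[p]) ^ a * p) • stdVec p a (2 * j) := by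
  induction k generalizing j with
  | zero =>
    obtain rfl : a = j + 1 := by omega
    rw [add_zero, pow_succ', ← Matrix.mulVec_mulVec,
      Omega_mul_Bblock_pow_mulVec_ascending p (Nat.lt_succ_self j), Matrix.mulVec_smul,
      ← Matrix.mulVec_mulVec, show 2 * j + 1 = 2 * (j + 1) - 1 by omega,
      Bblock_mulVec_last p j.succ_pos, show 2 * (j + 1) - 1 = 2 * j + 1 by omega,
      Matrix.mulVec_smul, Omega_mulVec_odd p j.lt_succ_self, smul_smul]
  | succ k ih =>
    rw [pow_succ', ← Matrix.mulVec_mulVec, ← add_assoc, ih (j := j + 1) (by omega),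
      Matrix.mulVec_smul, ← Matrix.mulVec_mulVec, show 2 * (j + 1) = 2 * j + 2 by ring,
      Bblock_mulVec_even p (by omega), Omega_mulVec_odd p (by omega)]

theorem Omega_mul_Bblock_pow (ha : 0 < a) :
    (OmegaList p a * Bblock p a) ^ (2 * a) = ((-1 : ℚ_[p]) ^ a * p) • 1 := by
  have hp : (p : ℚ_[p]) ≠ 0 := Nat.cast_ne_zero.2 (Fact.out : p.Prime).ne_zero
  set T := OmegaList p a * Bblock p a with hT
  have hcyc (i : Fin (2 * a)) :
      ∃ (m : ℕ) (c : ℚ_[p]), c ≠ 0 ∧ T ^ m *ᵥ stdVec p a 0 = c • stdVec p a i := by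
    rcases Nat.even_or_odd' (i : ℕ) with ⟨k, hk | hk⟩
    · refine ⟨a + (a - 1 - k) + 1, _, mul_ne_zero (pow_ne_zero a (neg_ne_zero.2 one_ne_zero)) hp, ?_⟩
      rw [hk]
      exact Omega_mul_Bblock_pow_mulVec_descending p (k := a - 1 - k) (by omega)
    · refine ⟨k + 1, _, pow_ne_zero (k + 1) (neg_ne_zero.2 one_ne_zero), ?_⟩
      rw [hk]
      exact Omega_mul_Bblock_pow_mulVec_ascending p (by omega)
  have hfull : T ^ (2 * a) *ᵥ stdVec p a 0 = ((-1 : ℚ_[p]) ^ a * p) • stdVec p a 0 := by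
    have := Omega_mul_Bblock_pow_mulVec_descending p (a := a) (k := a - 1) (j := 0) (by omega)
    rwa [show a + (a - 1) + 1 = 2 * a by omega] at this
  have hvec (i : Fin (2 * a)) :
      T ^ (2 * a) *ᵥ stdVec p a i = ((-1 : ℚ_[p]) ^ a * p) • stdVec p a i := by
    obtain ⟨m, c, hc, h⟩ := hcyc i
    apply smul_right_injective _ hc
    change c • _ = c • _
    rw [← Matrix.mulVec_smul, ← h, Matrix.mulVec_mulVec, ← pow_add, add_comm, pow_add,
      ← Matrix.mulVec_mulVec, hfull, Matrix.mulVec_smul, h, smul_comm]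
  ext i j
  have h := congrFun (hvec j) i
  rw [mulVec_stdVec] at h
  refine h.trans ?_
  simp [stdVec, Matrix.one_apply, Fin.ext_iff]

end BlockVectors

section Eisenstein

open Polynomial

theorem Polynomial.irreducible_X_pow_sub_C_of_prime {R : Type*} [CommRing R] [IsDomain R] {c : R}
    (hc : Prime c) {m : ℕ} (hm : 0 < m) : Irreducible (X ^ m - C c) := by
  have hmonic : (X ^ m - C c).Monic := monic_X_pow_sub_C c hm.ne'
  have hdeg : (X ^ m - C c).degree = (m : WithBot ℕ) := degree_X_pow_sub_C hm c
  have hprime : (Ideal.span {c}).IsPrime := (Ideal.span_singleton_prime hc.ne_zero).2 hc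
  refine irreducible_of_eisenstein_criterion hprime ?_ ?_ ?_ ?_ hmonic.isPrimitive
  · rw [hmonic.leadingCoeff]
    exact fun h => hprime.ne_top ((Ideal.eq_top_iff_one _).2 h)
  · intro k hk
    rw [hdeg, Nat.cast_lt] at hk
    rw [coeff_sub, coeff_X_pow, if_neg hk.ne, coeff_C, zero_sub, Ideal.neg_mem_iff]
    split_ifs
    · exact Ideal.mem_span_singleton_self c
    · exact zero_mem _
  · rw [hdeg]
    exact_mod_cast hm
  · rw [coeff_sub, coeff_X_pow, if_neg hm.ne, coeff_C_zero, zero_sub, Ideal.neg_mem_iff,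
      Ideal.span_singleton_pow, Ideal.mem_span_singleton]
    rw [sq]
    exact fun h => hc.not_isUnit (isUnit_of_dvd_one
      ((mul_dvd_mul_iff_left hc.ne_zero).1 (by rwa [mul_one])))

/-- The polynomial `X ^ (2 * a) - (-1) ^ a p` over `ℚ_p`. -/
noncomputable def blockPoly (p : ℕ) [Fact p.Prime] (a : ℕ) : ℚ_[p][X] :=
  X ^ (2 * a) - C ((-1) ^ a * (p : ℚ_[p]))

variable (p : ℕ) [Fact p.Prime] {a : ℕ}

theorem blockPoly_monic (ha : 0 < a) : (blockPoly p a).Monic :=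
  monic_X_pow_sub_C _ (by omega)

theorem natDegree_blockPoly (a : ℕ) : (blockPoly p a).natDegree = 2 * a :=
  natDegree_X_pow_sub_C

theorem blockPoly_irreducible (ha : 0 < a) : Irreducible (blockPoly p a) := by
  have hprime : Prime ((-1) ^ a * (p : ℤ_[p])) := by
    refine (Associated.prime_iff ?_).1 PadicInt.prime_p
    exact (associated_unit_mul_left _ _ (isUnit_one.neg.pow a)).symm
  have h := irreducible_X_pow_sub_C_of_prime hprime (m := 2 * a) (by omega)
  rw [(monic_X_pow_sub_C _ (by omega)).irreducible_iff_irreducible_map_fraction_map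
    (K := ℚ_[p])] at h
  simpa [blockPoly] using h

theorem charpoly_Omega_mul_Bblock (ha : 0 < a) :
    (OmegaList p a * Bblock p a).charpoly = blockPoly p a := by
  have haeval : aeval (OmegaList p a * Bblock p a) (blockPoly p a) = 0 := by
    rw [blockPoly, map_sub, map_pow, aeval_X, aeval_C, Omega_mul_Bblock_pow p ha,
      Algebra.algebraMap_eq_smul_one, sub_self]
  have : Nonempty (Fin (2 * a)) := ⟨⟨0, by omega⟩⟩
  have hmin : blockPoly p a = minpoly ℚ_[p] (OmegaList p a * Bblock p a) :=
    minpoly.eq_of_irreducible_of_monic (blockPoly_irreducible p ha) haeval (blockPoly_monic p ha)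
  have hdvd := Matrix.minpoly_dvd_charpoly (OmegaList p a * Bblock p a)
  rw [← hmin] at hdvd
  refine (eq_of_monic_of_dvd_of_natDegree_le (blockPoly_monic p ha)
    (Matrix.charpoly_monic _) hdvd ?_)
  rw [Matrix.charpoly_natDegree_eq_dim, natDegree_blockPoly, Fintype.card_fin]

theorem charpoly_Omega_mul_Mlist (n : ℕ) (l : List ℕ) (hl : ∀ a ∈ l, 0 < a) (h : l.sum = n) :
    (OmegaList p n * Mlist p n l h).charpoly = ((l : Multiset ℕ).map (blockPoly p)).prod := by
  have hsum : ∑ i : Fin l.length, 2 * l.get i = 2 * n := by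
    rw [← Finset.mul_sum, ← List.sum_ofFn, List.ofFn_get, h]
  rw [OmegaList_eq_reindex p n l.length l.get hsum, Mlist, Matrix.reindex_apply,
    Matrix.reindex_apply, Matrix.submatrix_mul_equiv, ← Matrix.reindex_apply,
    Matrix.charpoly_reindex, ← Matrix.blockDiagonal'_mul, Matrix.charpoly_blockDiagonal',
    Finset.prod_congr rfl fun i _ => charpoly_Omega_mul_Bblock p (hl _ (l.get_mem i)),
    ← List.prod_ofFn, Multiset.map_coe, Multiset.prod_coe]
  congr 1
  conv_rhs => rw [← List.ofFn_get l, List.map_ofFn]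
  rfl

theorem eq_of_prod_blockPoly_eq {s t : Multiset ℕ} (hs : ∀ a ∈ s, 0 < a) (ht : ∀ a ∈ t, 0 < a)
    (h : (s.map (blockPoly p)).prod = (t.map (blockPoly p)).prod) : s = t := by
  have hirr {u : Multiset ℕ} (hu : ∀ a ∈ u, 0 < a) (x) (hx : x ∈ u.map (blockPoly p)) :
      Irreducible x := by
    obtain ⟨a, ha, rfl⟩ := Multiset.mem_map.1 hx
    exact blockPoly_irreducible p (hu a ha)
  have hrel := UniqueFactorizationMonoid.factors_unique (hirr hs) (hirr ht) (Associated.of_eq h)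
  rw [Multiset.rel_map] at hrel
  rw [← Multiset.rel_eq]
  refine hrel.mono fun a _ b _ hab => ?_
  have := natDegree_eq_of_degree_eq (degree_eq_degree_of_associated hab)
  rw [natDegree_blockPoly, natDegree_blockPoly] at this
  omega

end Eisenstein

theorem charpoly_Omega_mul_congr {p n : ℕ} [Fact p.Prime]
    {S : Matrix (Fin (2 * n)) (Fin (2 * n)) ℚ_[p]} (hS : Sᵀ * OmegaList p n * S = OmegaList p n)
    (M : Matrix (Fin (2 * n)) (Fin (2 * n)) ℚ_[p]) :
    (OmegaList p n * (Sᵀ * M * S)).charpoly = (OmegaList p n * M).charpoly := by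
  have hleft : -(OmegaList p n * Sᵀ * OmegaList p n) * S = 1 := by
    rw [Matrix.neg_mul, Matrix.mul_assoc, Matrix.mul_assoc, ← Matrix.mul_assoc Sᵀ, hS,
      OmegaList_mul_self, neg_neg]
  have hright : S * OmegaList p n * Sᵀ = OmegaList p n := by
    have h := congrArg (· * OmegaList p n) (mul_eq_one_comm.1 hleft)
    simpa [Matrix.mul_assoc, OmegaList_mul_self] using h
  rw [← Matrix.mul_assoc, Matrix.charpoly_mul_comm, ← Matrix.mul_assoc, ← Matrix.mul_assoc,
    hright]

/-- If two lists of positive integers summing to `n` are distinct as multisets, the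
associated block matrices `M(l)` and `M(l')` are not equivalent by a symplectic
matrix. -/
theorem Mlist_not_symplectically_equivalent
    (p : ℕ) [Fact p.Prime] (n : ℕ) (hn : 0 < n)
    (l l' : List ℕ) (hl : ∀ a ∈ l, 0 < a) (hl' : ∀ a ∈ l', 0 < a)
    (hsum : l.sum = n) (hsum' : l'.sum = n)
    (hne : (l : Multiset ℕ) ≠ (l' : Multiset ℕ)) :
    ¬ ∃ S : Matrix (Fin (2 * n)) (Fin (2 * n)) ℚ_[p],
        Sᵀ * OmegaList p n * S = OmegaList p n ∧
        Sᵀ * Mlist p n l hsum * S = Mlist p n l' hsum' := by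
  rintro ⟨S, hS, hM⟩
  refine hne (eq_of_prod_blockPoly_eq p (fun a ha => hl a ha) (fun a ha => hl' a ha) ?_)
  rw [← charpoly_Omega_mul_Mlist p n l hl hsum, ← charpoly_Omega_mul_Mlist p n l' hl' hsum',
    ← hM, charpoly_Omega_mul_congr hS]
end

section
/- Let F be an algebraically closed field of characteristic different from 2 and let n be a positive integer. Let M₁ and M₂ be symmetric 2n×2n matrices over F, and set A₁ = Ω₀⁻¹ * M₁ and A₂ = Ω₀⁻¹ * M₂. Assume the characteristic polynomials of A₁ and of A₂ are both separable (equivalently, each Aᵢ has 2n pairwise distinct eigenvalues). Then there exists a symplectic matrix S over F with Sᵀ * M₁ * S = M₂ if and only if the characteristic polynomial of A₁ equals the characteristic polynomial of A₂. -/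
open Matrix

/-- The standard symplectic form on `F^(2n)`, with indices `Fin n × Fin 2`. -/
def OmegaStd (F : Type*) [Zero F] [One F] [Neg F] (n : ℕ) :
    Matrix (Fin n × Fin 2) (Fin n × Fin 2) F :=
  fun x y =>
    if x.1 = y.1 ∧ x.2 = 0 ∧ y.2 = 1 then 1
    else if x.1 = y.1 ∧ x.2 = 1 ∧ y.2 = 0 then -1
    else 0

open Polynomial

theorem OmegaStd_transpose (F : Type*) [Field F] (n : ℕ) :
    (OmegaStd F n)ᵀ = -OmegaStd F n := by
  ext ⟨i, a⟩ ⟨j, b⟩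
  by_cases h : i = j
  · subst h
    fin_cases a <;> fin_cases b <;> simp [OmegaStd]
  · simp [OmegaStd, h, Ne.symm h]

theorem OmegaStd_mul_self (F : Type*) [Field F] (n : ℕ) :
    OmegaStd F n * OmegaStd F n = -1 := by
  ext ⟨i, a⟩ ⟨j, b⟩
  rw [Matrix.mul_apply, Fintype.sum_prod_type, Finset.sum_eq_single i]
  · by_cases h : i = j
    · subst h
      fin_cases a <;> fin_cases b <;> simp [OmegaStd]
    · simp [OmegaStd, h]
  · intro k _ hk
    simp [OmegaStd, Ne.symm hk]
  · simp

theorem OmegaStd_isUnit (F : Type*) [Field F] (n : ℕ) : IsUnit (OmegaStd F n) :=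
  IsUnit.of_mul_eq_one (-OmegaStd F n) (by rw [mul_neg, OmegaStd_mul_self, neg_neg])

theorem exists_injective_isRoot_of_separable {F ι : Type*} [Field F] [IsAlgClosed F] [Fintype ι]
    {p : F[X]} (hp : p.Separable) (hcard : p.natDegree = Fintype.card ι) :
    ∃ l : ι → F, Function.Injective l ∧ ∀ i, p.IsRoot (l i) := by
  classical
  have hc : p.roots.toFinset.card = Fintype.card ι := by
    rw [Multiset.toFinset_card_of_nodup (nodup_roots hp), ← hcard]
    exact ((IsAlgClosed.splits p).natDegree_eq_card_roots).symm
  let e : ι ≃ p.roots.toFinset := Fintype.equivOfCardEq (by rw [Fintype.card_coe, hc])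
  refine ⟨fun i => (e i : F), Subtype.val_injective.comp e.injective, fun i => ?_⟩
  exact (Polynomial.mem_roots'.mp (Multiset.mem_toFinset.mp (e i).2)).2

theorem Matrix.exists_isUnit_mul_eq_mul_diagonal {F ι : Type*} [Field F] [Fintype ι]
    [DecidableEq ι] (A : Matrix ι ι F) {l : ι → F} (hl : Function.Injective l)
    (hroot : ∀ i, A.charpoly.IsRoot (l i)) :
    ∃ Q : Matrix ι ι F, IsUnit Q ∧ A * Q = Q * diagonal l := by
  have hev : ∀ i, ∃ v, Module.End.HasEigenvector (Matrix.toLin' A) (l i) v := fun i =>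
    ((Module.End.hasEigenvalue_iff_isRoot_charpoly _ _).mpr
      (by rw [Matrix.charpoly_toLin']; exact hroot i)).exists_hasEigenvector
  choose v hv using hev
  have hli : LinearIndependent F v :=
    Module.End.eigenvectors_linearIndependent' (Matrix.toLin' A) l hl v hv
  refine ⟨(Matrix.of v)ᵀ, linearIndependent_cols_iff_isUnit.mp hli, ?_⟩
  ext i j
  have h := congrFun (hv j).apply_eq_smul i
  rw [mul_diagonal]
  simpa [Matrix.mulVec, dotProduct, Matrix.mul_apply, mul_comm] using h

theorem Matrix.eq_diagonal_of_commute_diagonal {F ι : Type*} [Field F] [Fintype ι]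
    [DecidableEq ι] {B : Matrix ι ι F} {l : ι → F} (hl : Function.Injective l)
    (h : Commute B (diagonal l)) : B = diagonal B.diag := by
  ext i j
  by_cases hij : i = j
  · subst hij; simp
  · have hB := congrFun (congrFun h.eq i) j
    rw [mul_diagonal, diagonal_mul] at hB
    have : (l j - l i) * B i j = 0 := by linear_combination hB
    rw [diagonal_apply_ne _ hij]
    exact (mul_eq_zero.mp this).resolve_left (sub_ne_zero.mpr fun e => hij (hl e).symm)

theorem Matrix.exists_aeval_diagonal_mul_self {F ι : Type*} [Field F] [IsAlgClosed F] [Fintype ι]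
    [DecidableEq ι] (c : ι → F) :
    ∃ r : F[X], aeval (diagonal c) r * aeval (diagonal c) r = diagonal c := by
  classical
  choose s hs using fun x : F => IsAlgClosed.exists_eq_mul_self x
  let r := Lagrange.interpolate (Finset.univ.image c) id s
  refine ⟨r, ?_⟩
  have hr : ∀ i, r.eval (c i) = s (c i) := fun i =>
    Lagrange.eval_interpolate_at_node (v := id) s Function.injective_id.injOn
      (Finset.mem_image_of_mem c (Finset.mem_univ i))
  have hd : aeval (diagonal c) r = diagonal fun i => r.eval (c i) := by
    have := aeval_algHom_apply (diagonalAlgHom F : (ι → F) →ₐ[F] Matrix ι ι F) c r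
    rw [diagonalAlgHom_apply] at this
    rw [this, diagonalAlgHom_apply]
    congr 1
    ext i
    simp
  rw [hd, diagonal_mul_diagonal]
  simp [hr, ← hs]

theorem SemiconjBy.aeval {R A : Type*} [CommSemiring R] [Semiring A] [Algebra R A] {a x y : A}
    (h : SemiconjBy a x y) (p : R[X]) :
    SemiconjBy a (Polynomial.aeval x p) (Polynomial.aeval y p) := by
  induction p using Polynomial.induction_on' with
  | add p q hp hq => simpa using hp.add_right hq
  | monomial k r =>
    rw [aeval_monomial, aeval_monomial]
    exact SemiconjBy.mul_right (Algebra.commutes r a).symm (h.pow_right k)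

/-- A matrix commuting with a diagonalizable matrix with distinct eigenvalues has a square root
which is a polynomial in it. -/
theorem Matrix.exists_aeval_mul_self_of_commute {F ι : Type*} [Field F] [IsAlgClosed F]
    [Fintype ι] [DecidableEq ι] {A C Q : Matrix ι ι F} {l : ι → F} (hl : Function.Injective l)
    (hQ : IsUnit Q) (hAQ : A * Q = Q * diagonal l) (hCA : Commute C A) :
    ∃ r : F[X], aeval C r * aeval C r = C := by
  obtain ⟨u, rfl⟩ := hQ
  have hcomm : Commute (u⁻¹.val * C * u) (diagonal l) := by
    have hA : diagonal l = u⁻¹.val * A * u := by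
      rw [mul_assoc, hAQ, Units.inv_mul_cancel_left]
    rw [hA, Commute, SemiconjBy]
    simp only [mul_assoc, Units.mul_inv_cancel_left]
    rw [← mul_assoc C A, hCA.eq, mul_assoc]
  obtain ⟨r, hr⟩ := exists_aeval_diagonal_mul_self (u⁻¹.val * C * u).diag
  rw [← eq_diagonal_of_commute_diagonal hl hcomm] at hr
  refine ⟨r, ?_⟩
  have hsemi : SemiconjBy (u : Matrix ι ι F) (u⁻¹.val * C * u) C := by
    simp only [SemiconjBy, mul_assoc, Units.mul_inv_cancel_left]
  have hconj : aeval (u⁻¹.val * C * u) r = u⁻¹.val * aeval C r * u := by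
    rw [mul_assoc u⁻¹.val (aeval C r), ← (hsemi.aeval r).eq,
      Units.inv_mul_cancel_left]
  rw [hconj] at hr
  simp only [mul_assoc, Units.mul_inv_cancel_left] at hr
  have := u⁻¹.isUnit.mul_left_cancel hr
  rw [← mul_assoc] at this
  exact u.isUnit.mul_right_cancel this

theorem Matrix.transpose_aeval {R ι : Type*} [CommSemiring R] [Fintype ι] [DecidableEq ι]
    (C : Matrix ι ι R) (p : R[X]) : (Polynomial.aeval C p)ᵀ = Polynomial.aeval Cᵀ p := by
  induction p using Polynomial.induction_on' with
  | add p q hp hq => simp [hp, hq]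
  | monomial k r =>
    simp only [aeval_monomial, ← Algebra.smul_def, transpose_smul, transpose_pow]

/-- If `Ω` is antisymmetric, `Ω * A₁` and `Ω * A₂` are symmetric, and `A₁` and `A₂` are similar to
the same diagonal matrix with distinct entries, then the similarity can be chosen to preserve
`Ω`. -/
theorem Matrix.exists_preserving_of_diagonalizable {F ι : Type*} [Field F] [IsAlgClosed F]
    [Fintype ι] [DecidableEq ι] {Ω A₁ A₂ Q₁ Q₂ : Matrix ι ι F} {l : ι → F} (hΩ : Ωᵀ = -Ω)
    (hΩu : IsUnit Ω) (h₁ : (Ω * A₁)ᵀ = Ω * A₁) (h₂ : (Ω * A₂)ᵀ = Ω * A₂)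
    (hl : Function.Injective l) (hQ₁ : IsUnit Q₁) (hQ₂ : IsUnit Q₂)
    (hAQ₁ : A₁ * Q₁ = Q₁ * diagonal l) (hAQ₂ : A₂ * Q₂ = Q₂ * diagonal l) :
    ∃ S : Matrix ι ι F, Sᵀ * Ω * S = Ω ∧ Sᵀ * (Ω * A₁) * S = Ω * A₂ := by
  obtain ⟨P, hP, hAP⟩ : ∃ P : Matrix ι ι F, IsUnit P ∧ A₁ * P = P * A₂ := by
    obtain ⟨v, rfl⟩ := id hQ₂
    refine ⟨Q₁ * v⁻¹.val, hQ₁.mul v⁻¹.isUnit, ?_⟩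
    have hv : v⁻¹.val * A₂ = diagonal l * v⁻¹.val := by
      rw [Units.eq_mul_inv_iff_mul_eq, mul_assoc, hAQ₂, Units.inv_mul_cancel_left]
    rw [← mul_assoc, hAQ₁, mul_assoc, mul_assoc, hv]
  set W := Pᵀ * Ω * P with hW
  have hWA : W * A₂ = Pᵀ * (Ω * A₁) * P := by
    rw [hW, mul_assoc _ P, ← hAP]
    simp only [mul_assoc]
  have hWt : Wᵀ = -W := by
    simp [hW, hΩ, mul_assoc]
  have hWAt : (W * A₂)ᵀ = W * A₂ := by
    rw [hWA, transpose_mul, transpose_mul, transpose_transpose, h₁, mul_assoc Pᵀ]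
  obtain ⟨C, hC⟩ : ∃ C, Ω * C = W := by
    obtain ⟨w, rfl⟩ := hΩu
    exact ⟨w⁻¹.val * W, Units.mul_inv_cancel_left w W⟩
  have hCA : Commute C A₂ := by
    apply hΩu.mul_left_cancel
    rw [← mul_assoc, ← mul_assoc, hC, ← h₂, transpose_mul, hΩ, mul_neg, neg_mul,
      mul_assoc A₂ᵀ, hC, ← mul_neg, ← hWt, ← transpose_mul, hWAt]
  have hΩC : SemiconjBy Ω C Cᵀ := by
    have h : (Ω * C)ᵀ = -(Ω * C) := by rw [hC, hWt]
    rw [transpose_mul, hΩ, mul_neg, neg_inj] at h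
    exact h.symm
  have hCu : IsUnit C := by
    have hWu : IsUnit W := (((isUnit_transpose P).mpr hP).mul hΩu).mul hP
    rw [← hC] at hWu
    exact (hΩu.mul_left_iff).mp hWu
  obtain ⟨r, hr⟩ := exists_aeval_mul_self_of_commute hl hQ₂ hAQ₂ hCA
  have hΩD := (hΩC.aeval r).eq
  rw [← transpose_aeval] at hΩD
  have hDA : Commute (Polynomial.aeval C r) A₂ := (SemiconjBy.aeval hCA.symm r).symm
  generalize Polynomial.aeval C r = D at hr hΩD hDA
  have hDu : IsUnit D := isUnit_of_mul_isUnit_left (hr ▸ hCu)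
  obtain ⟨E, hDE⟩ := hDu.exists_right_inv
  have hEW : Eᵀ * W = Ω * D := by
    rw [← hC, ← hr, ← mul_assoc Ω, hΩD, mul_assoc, ← mul_assoc Eᵀ, ← transpose_mul, hDE,
      transpose_one, one_mul, hΩD]
  refine ⟨P * E, ?_, ?_⟩
  · calc (P * E)ᵀ * Ω * (P * E) = Eᵀ * W * E := by simp only [hW, transpose_mul, mul_assoc]
      _ = Ω := by rw [hEW, mul_assoc, hDE, mul_one]
  · calc (P * E)ᵀ * (Ω * A₁) * (P * E) = Eᵀ * (Pᵀ * (Ω * A₁) * P) * E := by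
          simp only [transpose_mul, mul_assoc]
      _ = Ω * (D * A₂) * E := by rw [← hWA, ← mul_assoc, hEW, mul_assoc Ω]
      _ = Ω * A₂ := by rw [hDA.eq, mul_assoc, mul_assoc, hDE, mul_one]

/-- Over an algebraically closed field of characteristic ≠ 2, two symmetric matrices
`M₁, M₂` whose associated matrices `Aᵢ = Ω₀⁻¹ * Mᵢ` have separable characteristic
polynomials are equivalent by a symplectic matrix iff the characteristic polynomials
coincide. -/
theorem symplectic_equiv_iff_charpoly_eq
    (F : Type*) [Field F] [IsAlgClosed F] (hchar : ringChar F ≠ 2)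
    (n : ℕ) (hn : 0 < n)
    (M₁ M₂ : Matrix (Fin n × Fin 2) (Fin n × Fin 2) F)
    (hM₁ : M₁ᵀ = M₁) (hM₂ : M₂ᵀ = M₂)
    (hsep₁ : ((OmegaStd F n)⁻¹ * M₁).charpoly.Separable)
    (hsep₂ : ((OmegaStd F n)⁻¹ * M₂).charpoly.Separable) :
    (∃ S : Matrix (Fin n × Fin 2) (Fin n × Fin 2) F,
        Sᵀ * OmegaStd F n * S = OmegaStd F n ∧ Sᵀ * M₁ * S = M₂) ↔
    ((OmegaStd F n)⁻¹ * M₁).charpoly = ((OmegaStd F n)⁻¹ * M₂).charpoly := by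
  have hΩu := OmegaStd_isUnit F n
  have hdet := (isUnit_iff_isUnit_det _).mp hΩu
  constructor
  · rintro ⟨S, hS, rfl⟩
    have hinv : (OmegaStd F n)⁻¹ * Sᵀ * OmegaStd F n * S = 1 := by
      rw [mul_assoc, mul_assoc, ← mul_assoc Sᵀ, hS, nonsing_inv_mul _ hdet]
    let u : (Matrix (Fin n × Fin 2) (Fin n × Fin 2) F)ˣ :=
      ⟨S, (OmegaStd F n)⁻¹ * Sᵀ * OmegaStd F n, mul_eq_one_comm.mp hinv, hinv⟩
    rw [← charpoly_units_conj' u ((OmegaStd F n)⁻¹ * M₁)]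
    congr 1
    rw [← coe_units_inv]
    change (OmegaStd F n)⁻¹ * Sᵀ * OmegaStd F n * ((OmegaStd F n)⁻¹ * M₁) * S = _
    rw [mul_assoc _ (OmegaStd F n), mul_nonsing_inv_cancel_left _ _ hdet]
    simp only [mul_assoc]
  · intro h
    obtain ⟨l, hl, hroot⟩ := exists_injective_isRoot_of_separable hsep₁ (charpoly_natDegree_eq_dim _)
    obtain ⟨Q₁, hQ₁, hAQ₁⟩ := exists_isUnit_mul_eq_mul_diagonal _ hl hroot
    obtain ⟨Q₂, hQ₂, hAQ₂⟩ := exists_isUnit_mul_eq_mul_diagonal _ hl (h ▸ hroot)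
    have hM (M) : OmegaStd F n * ((OmegaStd F n)⁻¹ * M) = M :=
      mul_nonsing_inv_cancel_left _ _ hdet
    have key := exists_preserving_of_diagonalizable (OmegaStd_transpose F n) hΩu
      (by rw [hM, hM₁]) (by rw [hM, hM₂]) hl hQ₁ hQ₂ hAQ₁ hAQ₂
    simpa only [hM] using key
end
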